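/- There exists a subgroup G ≤ W isomorphic to the dihedral group of order 14 such that: the action of G on the 56 exceptional classes has exactly four orbits, each of length 14 (so all point stabilizers are trivial); G is minimal; G fixes no conic class; and G satisfies condition (H1). -/

import Mathlib

open scoped BigOperators

noncomputable section

/-- The Picard lattice of a degree 2 del Pezzo surface. -/
abbrev V : Type := Fin 8 → ℤ

/-- The intersection form. -/
def bil (x y : V) : ℤ := x 0 * y 0 - ∑ i ∈ Finset.Ioi (0 : Fin 8), x i * y i

/-- The canonical class. -/
def Kvec : V := fun i => if i = 0 then -3 else 1

abbrev LatAut := V ≃ₗ[ℤ] V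

/-- The Weyl group: automorphisms preserving the form and fixing K. -/
def W : Subgroup LatAut where
  carrier := {g | (∀ x y, bil (g x) (g y) = bil x y) ∧ g Kvec = Kvec}
  one_mem' := ⟨fun _ _ => rfl, rfl⟩
  mul_mem' := by
    rintro a b ⟨ha1, ha2⟩ ⟨hb1, hb2⟩
    refine ⟨fun x y => ?_, ?_⟩
    · show bil (a (b x)) (a (b y)) = bil x y
      rw [ha1, hb1]
    · show a (b Kvec) = Kvec
      rw [hb2, ha2]
  inv_mem' := by
    rintro a ⟨ha1, ha2⟩
    refine ⟨fun x y => ?_, ?_⟩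
    · have h := ha1 (a⁻¹ x) (a⁻¹ y)
      have hx : a (a⁻¹ x) = x := a.apply_symm_apply x
      have hy : a (a⁻¹ y) = y := a.apply_symm_apply y
      rw [hx, hy] at h
      exact h.symm
    · have h2 : a.symm (a Kvec) = a.symm Kvec := by rw [ha2]
      rw [a.symm_apply_apply] at h2
      exact (show a⁻¹ Kvec = a.symm Kvec from rfl).trans h2.symm

/-- Exceptional classes. -/
def Exc : Set V := {E | bil E E = -1 ∧ bil E Kvec = -1}

/-- Conic classes. -/
def IsConic (C : V) : Prop := bil C C = 0 ∧ bil C Kvec = -2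

/-- The orbit of a vector under a subgroup of `LatAut`. -/
def orb (G : Subgroup LatAut) (E : V) : Set V := {v | ∃ g ∈ G, g E = v}

/-- The set of orbits of exceptional classes. -/
def orbs (G : Subgroup LatAut) : Set (Set V) := {S | ∃ E ∈ Exc, S = orb G E}

/-- The stabilizer of a vector, as a subgroup of `LatAut`. -/
def stab (G : Subgroup LatAut) (E : V) : Subgroup LatAut where
  carrier := {g | g ∈ G ∧ g E = E}
  one_mem' := ⟨G.one_mem, rfl⟩
  mul_mem' := by
    rintro a b ⟨haG, ha⟩ ⟨hbG, hb⟩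
    exact ⟨G.mul_mem haG hbG, by show a (b E) = E; rw [hb, ha]⟩
  inv_mem' := by
    rintro a ⟨haG, ha⟩
    refine ⟨G.inv_mem haG, ?_⟩
    conv_lhs => rw [← ha]
    exact a.symm_apply_apply E

/-- `G` is minimal: no nonempty orbit of exceptional classes consists of pairwise
orthogonal classes. -/
def MinimalAction (G : Subgroup LatAut) : Prop :=
  ∀ E ∈ Exc, ¬ (∀ E₁ ∈ orb G E, ∀ E₂ ∈ orb G E, E₁ ≠ E₂ → bil E₁ E₂ = 0)

/-- The natural representation of a subgroup of `LatAut` on the lattice. -/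
def rep (G : Subgroup LatAut) : Representation ℤ G V where
  toFun g := (g : LatAut).toLinearMap
  map_one' := rfl
  map_mul' _ _ := rfl

/-- Condition (H1): the first group cohomology of every subgroup of `G`
with coefficients in the lattice vanishes. -/
def CondH1 (G : Subgroup LatAut) : Prop :=
  ∀ G' : Subgroup LatAut, G' ≤ G →
    Subsingleton (groupCohomology.H1 (Rep.of (rep G')))

open DihedralGroup

/-- The coefficients of a class at the seven exceptional curves, indexed by `ZMod 7`. -/
def coord (x : V) (j : ZMod 7) : ℤ := x (Fin.succ (n := 7) j)

/-- The class with given coefficient at the line class and given exceptional coefficients. -/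
def ofCoords (a : ℤ) (b : ZMod 7 → ℤ) : V := Fin.cons (α := fun _ => ℤ) a b

@[simp] lemma ofCoords_zero (a : ℤ) (b : ZMod 7 → ℤ) : ofCoords a b 0 = a := rfl

@[simp] lemma coord_ofCoords (a : ℤ) (b : ZMod 7 → ℤ) (j : ZMod 7) :
    coord (ofCoords a b) j = b j := rfl

@[simp] lemma coord_add (x y : V) (j : ZMod 7) : coord (x + y) j = coord x j + coord y j := rfl

@[simp] lemma coord_sub (x y : V) (j : ZMod 7) : coord (x - y) j = coord x j - coord y j := rfl

@[simp] lemma coord_smul (c : ℤ) (x : V) (j : ZMod 7) : coord (c • x) j = c * coord x j := rfl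

@[simp] lemma coord_zero (j : ZMod 7) : coord 0 j = 0 := rfl

@[simp] lemma Kvec_zero : Kvec 0 = -3 := rfl

@[simp] lemma coord_Kvec (j : ZMod 7) : coord Kvec j = 1 :=
  if_neg (t := (-3 : ℤ)) (Fin.succ_ne_zero (n := 7) j)

lemma ext_coord {x y : V} (h0 : x 0 = y 0) (h : ∀ j, coord x j = coord y j) : x = y := by
  funext i
  exact Fin.cases h0 h i

lemma bil_eq_coord (x y : V) :
    bil x y = x 0 * y 0 - ∑ j : ZMod 7, coord x j * coord y j := by
  rw [bil, Fin.Ioi_zero_eq_map, Finset.sum_map]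
  rfl

lemma bil_Kvec (x : V) : bil x Kvec = -3 * x 0 - ∑ j : ZMod 7, coord x j := by
  simp [bil_eq_coord]
  ring

/-- The action of the dihedral group on the lattice: rotations permute the exceptional curves
cyclically, and reflections are reflections of the exceptional curves composed with the Geiser
involution `x ↦ ⟨x, K⟩ K - x`. -/
def dihedralAct : DihedralGroup 7 → V → V
  | r k, x => ofCoords (x 0) fun j => coord x (j + k)
  | sr k, x => ofCoords (-3 * bil x Kvec - x 0) fun j => bil x Kvec - coord x (k - j)

@[simp] lemma dihedralAct_r_zero (k : ZMod 7) (x : V) : dihedralAct (r k) x 0 = x 0 := rfl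

@[simp] lemma coord_dihedralAct_r (k : ZMod 7) (x : V) (j : ZMod 7) :
    coord (dihedralAct (r k) x) j = coord x (j + k) := rfl

@[simp] lemma dihedralAct_sr_zero (k : ZMod 7) (x : V) :
    dihedralAct (sr k) x 0 = -3 * bil x Kvec - x 0 := rfl

@[simp] lemma coord_dihedralAct_sr (k : ZMod 7) (x : V) (j : ZMod 7) :
    coord (dihedralAct (sr k) x) j = bil x Kvec - coord x (k - j) := rfl

lemma sum_add_right (f : ZMod 7 → ℤ) (k : ZMod 7) : ∑ j, f (j + k) = ∑ j, f j :=
  Equiv.sum_comp (Equiv.addRight k) f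

lemma sum_sub_left (f : ZMod 7 → ℤ) (k : ZMod 7) : ∑ j, f (k - j) = ∑ j, f j :=
  Equiv.sum_comp (Equiv.subLeft k) f

lemma dihedralAct_Kvec (d : DihedralGroup 7) : dihedralAct d Kvec = Kvec := by
  have h : bil Kvec Kvec = 2 := by rw [bil_Kvec]; simp
  cases d <;> apply ext_coord <;> simp [h]

lemma bil_dihedralAct (d : DihedralGroup 7) (x y : V) :
    bil (dihedralAct d x) (dihedralAct d y) = bil x y := by
  cases d with
  | r k =>
    simp only [bil_eq_coord, dihedralAct_r_zero, coord_dihedralAct_r]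
    rw [sum_add_right (fun j => coord x j * coord y j)]
  | sr k =>
    have hx := bil_Kvec x
    have hy := bil_Kvec y
    rw [bil_eq_coord, bil_eq_coord x y]
    simp only [dihedralAct_sr_zero, coord_dihedralAct_sr]
    rw [sum_sub_left (fun j => (bil x Kvec - coord x j) * (bil y Kvec - coord y j))]
    simp only [sub_mul, mul_sub, Finset.sum_sub_distrib, ← Finset.mul_sum, ← Finset.sum_mul]
    rw [show ∑ j, coord x j = -3 * x 0 - bil x Kvec by linarith,
      show ∑ j, coord y j = -3 * y 0 - bil y Kvec by linarith]
    simp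
    ring

lemma bil_dihedralAct_Kvec (d : DihedralGroup 7) (x : V) :
    bil (dihedralAct d x) Kvec = bil x Kvec := by
  conv_lhs => rw [← dihedralAct_Kvec d, bil_dihedralAct]

lemma dihedralAct_one (x : V) : dihedralAct 1 x = x := by
  rw [one_def]
  apply ext_coord <;> simp only [dihedralAct_r_zero, coord_dihedralAct_r, add_zero, implies_true]

lemma dihedralAct_mul (a b : DihedralGroup 7) (x : V) :
    dihedralAct (a * b) x = dihedralAct a (dihedralAct b x) := by
  cases a <;> cases b <;> apply ext_coord <;>
    simp [bil_dihedralAct_Kvec, add_assoc, sub_add_eq_sub_sub, sub_sub_eq_add_sub] <;>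
    intros <;> congr 1 <;> ring

lemma bil_add_left (x y z : V) : bil (x + y) z = bil x z + bil y z := by
  simp only [bil_eq_coord, Pi.add_apply, coord_add, add_mul, Finset.sum_add_distrib]
  ring

lemma bil_smul_left (c : ℤ) (x z : V) : bil (c • x) z = c * bil x z := by
  simp only [bil_eq_coord, Pi.smul_apply, smul_eq_mul, coord_smul, mul_assoc, ← Finset.mul_sum]
  ring

/-- The dihedral action as a representation. -/
def dihedralRep : DihedralGroup 7 →* (V →ₗ[ℤ] V) where
  toFun d :=
    { toFun := dihedralAct d
      map_add' := fun x y => by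
        cases d <;> apply ext_coord <;> simp [bil_add_left] <;> intros <;> ring
      map_smul' := fun c x => by
        cases d <;> apply ext_coord <;> simp [bil_smul_left, -zsmul_eq_mul] <;> intros <;> ring }
  map_one' := LinearMap.ext dihedralAct_one
  map_mul' a b := LinearMap.ext (dihedralAct_mul a b)

/-- The dihedral action by lattice automorphisms. -/
def dihedralHom : DihedralGroup 7 →* LatAut :=
  (LinearMap.GeneralLinearGroup.generalLinearEquiv ℤ V).toMonoidHom.comp dihedralRep.toHomUnits

@[simp] lemma dihedralHom_apply (d : DihedralGroup 7) (x : V) :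
    dihedralHom d x = dihedralAct d x := rfl

/-- Representatives of the four orbits on exceptional classes: `E₀` and the lines through two of
the seven points. -/
def orbitRep (j : Fin 4) : V :=
  if j = 0 then ofCoords 0 fun i => if i = 0 then 1 else 0
  else ofCoords 1 fun i => if i = 0 ∨ i = (j : ℕ) then -1 else 0

lemma eq_one_of_dihedralAct_orbitRep : ∀ (d : DihedralGroup 7) (i j : Fin 4),
    dihedralAct d (orbitRep i) = orbitRep j → d = 1 ∧ i = j := by
  decide +kernel

lemma exists_bil_orbitRep_eq_two :
    ∀ j : Fin 4, ∃ d, bil (orbitRep j) (dihedralAct d (orbitRep j)) = 2 := by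
  decide +kernel

lemma orbitRep_mem_Exc (j : Fin 4) : orbitRep j ∈ Exc := by
  revert j
  unfold Exc
  simp only [Set.mem_ofPred_eq]
  decide +kernel

/-- The smaller of the two values taken by the exceptional coefficients of an exceptional class
of degree `a`. -/
def lowCoord (a : Fin 4) : ℤ := if a = 0 then 0 else if a = 3 then -2 else -1

/-- A class of degree `a` with exceptional coefficients in `{lowCoord a, lowCoord a + 1}`. -/
def candidate (a : Fin 4) (b : ZMod 7 → Bool) : V :=
  ofCoords (a : ℕ) fun j => if b j then lowCoord a + 1 else lowCoord a

lemma exists_eq_candidate {E : V} (hE : E ∈ Exc) : ∃ a b, E = candidate a b := by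
  obtain ⟨hsq, hK⟩ := hE
  rw [bil_eq_coord] at hsq
  rw [bil_Kvec] at hK
  have hcs := sq_sum_le_card_mul_sum_sq (s := Finset.univ) (f := coord E)
  simp only [Finset.card_univ, ZMod.card, sq] at hcs
  have h1 : ∑ j, coord E j = 1 - 3 * E 0 := by linarith
  have h2 : ∑ j, coord E j * coord E j = E 0 * E 0 + 1 := by linarith
  rw [h1, h2] at hcs
  push_cast at hcs
  have hlo : 0 ≤ E 0 := by
    by_contra! h
    nlinarith
  have hhi : E 0 < 4 := by
    by_contra! h
    nlinarith
  obtain ⟨a, ha⟩ : ∃ a : Fin 4, E 0 = (a : ℕ) :=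
    ⟨⟨(E 0).toNat, by omega⟩, by simp [hlo]⟩
  have hzero : ∑ j, (coord E j - lowCoord a) * (coord E j - (lowCoord a + 1)) = 0 := by
    have hexp : ∀ j, (coord E j - lowCoord a) * (coord E j - (lowCoord a + 1)) =
        coord E j * coord E j - (2 * lowCoord a + 1) * coord E j
          + lowCoord a * (lowCoord a + 1) := fun j => by ring
    simp only [hexp, Finset.sum_add_distrib, Finset.sum_sub_distrib, ← Finset.mul_sum, h1, h2, ha]
    fin_cases a <;> simp [lowCoord]
  have hnonneg : ∀ j ∈ Finset.univ,
      0 ≤ (coord E j - lowCoord a) * (coord E j - (lowCoord a + 1)) := fun j _ => by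
    rcases le_or_gt (coord E j) (lowCoord a) with h | h <;> nlinarith
  have hterm := (Finset.sum_eq_zero_iff_of_nonneg hnonneg).1 hzero
  refine ⟨a, fun j => decide (coord E j = lowCoord a + 1), ext_coord ha fun j => ?_⟩
  simp only [candidate, coord_ofCoords, decide_eq_true_eq]
  split_ifs with h
  · exact h
  · rcases mul_eq_zero.1 (hterm j (Finset.mem_univ j)) with h' | h'
    · linarith
    · exact absurd (by linarith) h

lemma exists_candidate_eq_dihedralAct : ∀ (a : Fin 4) (b : ZMod 7 → Bool),
    bil (candidate a b) (candidate a b) = -1 → bil (candidate a b) Kvec = -1 →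
      ∃ d j, candidate a b = dihedralAct d (orbitRep j) := by
  decide +kernel

lemma exists_eq_dihedralAct_orbitRep {E : V} (hE : E ∈ Exc) :
    ∃ d j, E = dihedralAct d (orbitRep j) := by
  obtain ⟨a, b, rfl⟩ := exists_eq_candidate hE
  exact exists_candidate_eq_dihedralAct a b hE.1 hE.2

lemma dihedralAct_injective (d : DihedralGroup 7) : Function.Injective (dihedralAct d) :=
  (dihedralHom d).injective

lemma eq_one_of_dihedralAct_eq_self {E : V} (hE : E ∈ Exc) {d : DihedralGroup 7}
    (hd : dihedralAct d E = E) : d = 1 := by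
  obtain ⟨a, j, rfl⟩ := exists_eq_dihedralAct_orbitRep hE
  have h : dihedralAct (a⁻¹ * d * a) (orbitRep j) = orbitRep j := by
    apply dihedralAct_injective a
    rw [← dihedralAct_mul, mul_assoc, mul_inv_cancel_left, dihedralAct_mul, hd]
  have := (eq_one_of_dihedralAct_orbitRep _ _ _ h).1
  simpa [mul_assoc, inv_mul_eq_one] using this

lemma dihedralHom_injective : Function.Injective dihedralHom := by
  rw [injective_iff_map_eq_one]
  intro d hd
  refine eq_one_of_dihedralAct_eq_self (orbitRep_mem_Exc 0) ?_
  rw [← dihedralHom_apply, hd]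
  rfl

lemma orb_range (E : V) : orb dihedralHom.range E = Set.range fun d => dihedralAct d E := by
  ext v
  simp [orb, MonoidHom.mem_range]

lemma orb_dihedralAct (d : DihedralGroup 7) (E : V) :
    orb dihedralHom.range (dihedralAct d E) = orb dihedralHom.range E := by
  rw [orb_range, orb_range]
  simp only [← dihedralAct_mul]
  exact (Equiv.mulRight d).surjective.range_comp fun a => dihedralAct a E

lemma ncard_orb {E : V} (hE : E ∈ Exc) : (orb dihedralHom.range E).ncard = 14 := by
  have hinj : Function.Injective fun d => dihedralAct d E := fun a b h => by
    have h' : dihedralAct (a⁻¹ * b) E = E := by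
      apply dihedralAct_injective a
      rw [← dihedralAct_mul, mul_inv_cancel_left]
      exact h.symm
    exact inv_mul_eq_one.1 (eq_one_of_dihedralAct_eq_self hE h')
  rw [orb_range, ← Set.image_univ, Set.ncard_image_of_injective _ hinj, Set.ncard_univ,
    DihedralGroup.nat_card]

lemma stab_eq_bot {E : V} (hE : E ∈ Exc) : stab dihedralHom.range E = ⊥ := by
  rw [Subgroup.eq_bot_iff_forall]
  rintro _ ⟨⟨d, rfl⟩, hd⟩
  rw [eq_one_of_dihedralAct_eq_self hE hd, map_one]

lemma ncard_orbs : (orbs dihedralHom.range).ncard = 4 := by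
  have hrange : orbs dihedralHom.range =
      Set.range fun j => orb dihedralHom.range (orbitRep j) := by
    ext S
    constructor
    · rintro ⟨E, hE, rfl⟩
      obtain ⟨d, j, rfl⟩ := exists_eq_dihedralAct_orbitRep hE
      exact ⟨j, (orb_dihedralAct d _).symm⟩
    · rintro ⟨j, rfl⟩
      exact ⟨_, orbitRep_mem_Exc j, rfl⟩
  have hinj : Function.Injective fun j => orb dihedralHom.range (orbitRep j) := fun i j h => by
    have hmem : orbitRep j ∈ orb dihedralHom.range (orbitRep i) :=
      (Set.ext_iff.1 h _).2 ⟨1, one_mem _, rfl⟩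
    rw [orb_range] at hmem
    obtain ⟨d, hd⟩ := hmem
    exact (eq_one_of_dihedralAct_orbitRep d i j hd).2
  rw [hrange, ← Set.image_univ, Set.ncard_image_of_injective _ hinj, Set.ncard_univ, Nat.card_fin]

lemma minimalAction_range : MinimalAction dihedralHom.range := by
  intro E hE horth
  obtain ⟨a, j, rfl⟩ := exists_eq_dihedralAct_orbitRep hE
  rw [orb_dihedralAct, orb_range] at horth
  obtain ⟨d, hd⟩ := exists_bil_orbitRep_eq_two j
  have hself : bil (orbitRep j) (orbitRep j) = -1 := (orbitRep_mem_Exc j).1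
  have hne : orbitRep j ≠ dihedralAct d (orbitRep j) := fun h => by
    rw [← h, hself] at hd
    norm_num at hd
  have hzero := horth _ ⟨1, dihedralAct_one _⟩ _ ⟨d, rfl⟩ hne
  rw [hd] at hzero
  norm_num at hzero

lemma not_exists_fixed_conic :
    ¬ ∃ C, IsConic C ∧ ∀ g ∈ dihedralHom.range, g C = C := by
  rintro ⟨C, ⟨hsq, hK⟩, hfix⟩
  have hr (k : ZMod 7) : coord C k = coord C 0 := by
    have h := congrArg (fun x => coord x 0) (hfix _ ⟨r k, rfl⟩)
    simpa using h
  have hs := hfix _ ⟨sr 0, rfl⟩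
  have hs0 := congrFun hs 0
  simp only [dihedralHom_apply, dihedralAct_sr_zero, hK] at hs0
  have hs1 := congrArg (fun x => coord x 0) hs
  simp only [dihedralHom_apply, coord_dihedralAct_sr, hK, sub_zero] at hs1
  rw [bil_eq_coord] at hsq
  simp only [hr] at hsq
  simp only [Finset.sum_const, Finset.card_univ, ZMod.card, nsmul_eq_mul] at hsq
  rw [show C 0 = 3 by omega, show coord C 0 = -1 by omega] at hsq
  norm_num at hsq

lemma dihedralAct_zero (d : DihedralGroup 7) : dihedralAct d 0 = 0 :=
  LinearEquiv.map_zero (dihedralHom d)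

lemma dihedralAct_add (d : DihedralGroup 7) (x y : V) :
    dihedralAct d (x + y) = dihedralAct d x + dihedralAct d y := (dihedralHom d).map_add x y

lemma dihedralAct_sub (d : DihedralGroup 7) (x y : V) :
    dihedralAct d (x - y) = dihedralAct d x - dihedralAct d y := (dihedralHom d).map_sub x y

/-- `F` satisfies the `1`-cocycle identity on `H`. -/
def IsCocycleOn (H : Subgroup (DihedralGroup 7)) (F : DihedralGroup 7 → V) : Prop :=
  ∀ a ∈ H, ∀ b ∈ H, F (a * b) = dihedralAct a (F b) + F a

lemma IsCocycleOn.map_one {H : Subgroup (DihedralGroup 7)} {F : DihedralGroup 7 → V}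
    (hF : IsCocycleOn H F) : F 1 = 0 := by
  have h := hF 1 H.one_mem 1 H.one_mem
  rw [mul_one, dihedralAct_one] at h
  simpa using h

/-- Subtracting a coboundary preserves the cocycle identity. -/
lemma IsCocycleOn.sub_coboundary {H : Subgroup (DihedralGroup 7)} {F : DihedralGroup 7 → V}
    (hF : IsCocycleOn H F) (v : V) : IsCocycleOn H fun a => F a - (dihedralAct a v - v) := by
  intro a ha b hb
  simp only [hF a ha b hb, dihedralAct_sub, dihedralAct_mul]
  abel

/-- A cocycle defined on all rotations is a coboundary there. -/
lemma IsCocycleOn.exists_rotation {H : Subgroup (DihedralGroup 7)} {F : DihedralGroup 7 → V}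
    (hF : IsCocycleOn H F) (hr : ∀ k, r k ∈ H) :
    ∃ v, ∀ k, F (r k) = dihedralAct (r k) v - v := by
  have hadd (j k : ZMod 7) : F (r (j + k)) = dihedralAct (r j) (F (r k)) + F (r j) :=
    hF _ (hr j) _ (hr k)
  refine ⟨ofCoords 0 fun j => coord (F (r j)) 0, fun k => ext_coord ?_ fun j => ?_⟩
  · let φ : ZMod 7 →+ ℤ := AddMonoidHom.mk' (fun k => F (r k) 0) fun j k => by
      simp [hadd, add_comm]
    have h : 7 • φ k = 0 := by
      rw [← map_nsmul, ZModModule.char_nsmul_eq_zero 7 k, map_zero]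
    have h' : F (r k) 0 = 0 := (smul_eq_zero.1 h).resolve_left (by norm_num)
    simpa using h'
  · simp [hadd]

/-- An anti-invariant vector of the reflection `sr 0` is a coboundary. -/
lemma exists_sr_zero_sub_eq {x : V} (hx : dihedralAct (sr 0) x + x = 0) :
    ∃ v, dihedralAct (sr 0) v - v = x := by
  have hK : bil x Kvec = 0 := by
    have h := bil_dihedralAct_Kvec (sr 0) x
    have h0 : bil (dihedralAct (sr 0) x + x) Kvec = 0 := by rw [hx]; simp [bil_eq_coord]
    rw [bil_add_left] at h0
    omega
  have hc (j : ZMod 7) : coord x (-j) = coord x j := by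
    have h := congrArg (fun y => coord y j) hx
    simp [hK] at h
    omega
  have h6 : coord x 6 = coord x 1 := hc 1
  have h5 : coord x 5 = coord x 2 := hc 2
  have h4 : coord x 4 = coord x 3 := hc 3
  have hsum (f : ZMod 7 → ℤ) : ∑ j, f j = f 0 + f 1 + f 2 + f 3 + f 4 + f 5 + f 6 :=
    Fin.sum_univ_seven f
  rw [bil_Kvec, hsum, h4, h5, h6] at hK
  obtain ⟨p, hp⟩ : ∃ p, 2 * p = -x 0 - coord x 0 := ⟨(-x 0 - coord x 0) / 2, by omega⟩
  let b : ZMod 7 → ℤ :=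
    ![p, -x 0 - coord x 1, -x 0 - coord x 2, -x 0 - coord x 3, 0, 0, 0]
  have hv : bil (ofCoords (x 0) b) Kvec = -x 0 := by
    rw [bil_Kvec, hsum]
    change -3 * x 0 - (p + (-x 0 - coord x 1) + (-x 0 - coord x 2) + (-x 0 - coord x 3)
      + 0 + 0 + 0) = -x 0
    omega
  have hb : ∀ j, -x 0 - b (0 - j) - b j = coord x j := by
    intro j
    fin_cases j
    · change -x 0 - p - p = coord x 0
      omega
    · change -x 0 - 0 - (-x 0 - coord x 1) = coord x 1
      omega
    · change -x 0 - 0 - (-x 0 - coord x 2) = coord x 2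
      omega
    · change -x 0 - 0 - (-x 0 - coord x 3) = coord x 3
      omega
    · change -x 0 - (-x 0 - coord x 3) - 0 = coord x 4
      omega
    · change -x 0 - (-x 0 - coord x 2) - 0 = coord x 5
      omega
    · change -x 0 - (-x 0 - coord x 1) - 0 = coord x 6
      omega
  refine ⟨ofCoords (x 0) b, ext_coord ?_ fun j => ?_⟩
  · rw [Pi.sub_apply, dihedralAct_sr_zero, hv, ofCoords_zero]
    ring
  · rw [coord_sub, coord_dihedralAct_sr, hv, coord_ofCoords, coord_ofCoords, hb]

/-- An anti-invariant vector of any reflection is a coboundary. -/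
lemma exists_sr_sub_eq (k : ZMod 7) {x : V} (hx : dihedralAct (sr k) x + x = 0) :
    ∃ v, dihedralAct (sr k) v - v = x := by
  have hconj : r (4 * k) * sr k = sr 0 * r (4 * k) := by
    clear hx
    revert k
    decide
  have hx' : dihedralAct (sr 0) (dihedralAct (r (4 * k)) x) + dihedralAct (r (4 * k)) x = 0 := by
    rw [← dihedralAct_mul, ← hconj, dihedralAct_mul, ← dihedralAct_add, hx,
      dihedralAct_zero]
  obtain ⟨v, hv⟩ := exists_sr_zero_sub_eq hx'
  obtain ⟨u, rfl⟩ := (dihedralHom (r (4 * k))).surjective v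
  refine ⟨u, dihedralAct_injective (r (4 * k)) ?_⟩
  rw [dihedralAct_sub, ← dihedralAct_mul, hconj, dihedralAct_mul]
  exact hv

/-- Every cocycle on a subgroup of the dihedral group is a coboundary. -/
lemma IsCocycleOn.exists_coboundary {H : Subgroup (DihedralGroup 7)} {F : DihedralGroup 7 → V}
    (hF : IsCocycleOn H F) : ∃ v, ∀ a ∈ H, F a = dihedralAct a v - v := by
  by_cases h1 : r 1 ∈ H
  · have hr (k : ZMod 7) : r k ∈ H := by
      have h := H.pow_mem h1 k.val
      rwa [r_one_pow, ZMod.natCast_zmod_val] at h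
    obtain ⟨v, hv⟩ := hF.exists_rotation hr
    by_cases hs : sr 0 ∈ H
    · have hF' := hF.sub_coboundary v
      set F' : DihedralGroup 7 → V := fun a => F a - (dihedralAct a v - v)
      have hF'r (k : ZMod 7) : F' (r k) = 0 := sub_eq_zero.2 (hv k)
      have hF's (k : ZMod 7) : F' (sr k) = F' (sr 0) := by
        have h := hF' _ hs _ (hr k)
        rw [sr_mul_r, zero_add, hF'r] at h
        rw [h, dihedralAct_zero, zero_add]
      have hinv (k : ZMod 7) : dihedralAct (r k) (F' (sr 0)) = F' (sr 0) := by
        have h := hF' _ (hr k) _ hs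
        rw [r_mul_sr, hF'r, add_zero, hF's] at h
        exact h.symm
      have hanti : dihedralAct (sr 0) (F' (sr 0)) + F' (sr 0) = 0 := by
        rw [← hF' _ hs _ hs, sr_mul_self, hF'.map_one]
      have hcoord (k : ZMod 7) : coord (F' (sr 0)) k = coord (F' (sr 0)) 0 := by
        simpa using congrArg (fun x => coord x 0) (hinv k)
      have h0 := congrFun hanti 0
      have h1 := congrArg (fun x => coord x 0) hanti
      simp only [Pi.add_apply, dihedralAct_sr_zero, coord_add, coord_dihedralAct_sr, sub_zero,
        coord_zero, Pi.zero_apply] at h0 h1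
      have hK := bil_Kvec (F' (sr 0))
      simp only [hcoord, Finset.sum_const, Finset.card_univ, ZMod.card, nsmul_eq_mul] at hK
      push_cast at hK
      obtain ⟨m, hm0, hm1⟩ : ∃ m, F' (sr 0) 0 = 7 * m ∧ coord (F' (sr 0)) 0 = -3 * m :=
        ⟨F' (sr 0) 0 / 7, by omega, by omega⟩
      have hw : bil (ofCoords m 0) Kvec = -3 * m := by simp [bil_Kvec]
      have hws (k : ZMod 7) :
          F' (sr k) = dihedralAct (sr k) (ofCoords m 0) - ofCoords m 0 := by
        rw [hF's]
        apply ext_coord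
        · simp only [Pi.sub_apply, dihedralAct_sr_zero, hw, hm0, ofCoords_zero]
          ring
        · intro j
          simp [hw, hcoord, hm1]
      have hwr (k : ZMod 7) :
          F' (r k) = dihedralAct (r k) (ofCoords m 0) - ofCoords m 0 := by
        rw [hF'r]
        apply ext_coord <;> simp
      refine ⟨v + ofCoords m 0, fun a _ => ?_⟩
      have ha : F' a = dihedralAct a (ofCoords m 0) - ofCoords m 0 := by
        cases a with
        | r k => exact hwr k
        | sr k => exact hws k
      rw [sub_eq_iff_eq_add.1 ha, dihedralAct_add]
      abel
    · refine ⟨v, fun a ha => ?_⟩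
      cases a with
      | r k => exact hv k
      | sr k =>
        have h := H.mul_mem ha (hr (-k))
        rw [sr_mul_r, add_neg_cancel] at h
        exact absurd h hs
  · have hrot (k : ZMod 7) (hk : r k ∈ H) : k = 0 := by
      by_contra hne
      have h := H.pow_mem hk (k⁻¹).val
      have : Fact (Nat.Prime 7) := ⟨by norm_num⟩
      rw [r_pow, ZMod.natCast_zmod_val, mul_inv_cancel₀ hne] at h
      exact h1 h
    by_cases hs : ∃ k, sr k ∈ H
    · obtain ⟨k, hk⟩ := hs
      have hanti : dihedralAct (sr k) (F (sr k)) + F (sr k) = 0 := by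
        rw [← hF _ hk _ hk, sr_mul_self, hF.map_one]
      obtain ⟨v, hv⟩ := exists_sr_sub_eq k hanti
      refine ⟨v, fun a ha => ?_⟩
      cases a with
      | r i =>
        rw [hrot i ha, r_zero, hF.map_one, dihedralAct_one, sub_self]
      | sr i =>
        have h := H.mul_mem hk ha
        rw [sr_mul_sr] at h
        rw [sub_eq_zero.1 (hrot _ h), hv]
    · refine ⟨0, fun a ha => ?_⟩
      cases a with
      | r i =>
        rw [hrot i ha, r_zero, hF.map_one, dihedralAct_one, sub_self]
      | sr i => exact absurd ⟨i, ha⟩ hs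

open Classical in
lemma condH1_range : CondH1 dihedralHom.range := by
  intro G' hG'
  refine subsingleton_of_forall_eq 0 fun y => ?_
  induction y using groupCohomology.H1_induction_on with
  | h f =>
    rw [groupCohomology.H1π_eq_zero_iff]
    have hf := (groupCohomology.mem_cocycles₁_iff (A := Rep.of (rep G')) f).1 f.2
    let F : DihedralGroup 7 → V := fun d =>
      if hd : dihedralHom d ∈ G' then f ⟨dihedralHom d, hd⟩ else 0
    have hFd (d : DihedralGroup 7) (hd : dihedralHom d ∈ G') :
        F d = f ⟨dihedralHom d, hd⟩ := dif_pos hd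
    have hF : IsCocycleOn (G'.comap dihedralHom) F := by
      intro a ha b hb
      have hab : dihedralHom (a * b) ∈ G' := (G'.comap dihedralHom).mul_mem ha hb
      rw [hFd _ hab, hFd _ ha, hFd _ hb]
      have h := hf ⟨dihedralHom a, ha⟩ ⟨dihedralHom b, hb⟩
      have hmul : (⟨dihedralHom (a * b), hab⟩ : G') =
          ⟨dihedralHom a, ha⟩ * ⟨dihedralHom b, hb⟩ := Subtype.ext (map_mul _ _ _)
      rw [hmul]
      exact h
    obtain ⟨v, hv⟩ := hF.exists_coboundary
    refine ⟨v, funext ?_⟩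
    rintro ⟨g, hg⟩
    obtain ⟨d, rfl⟩ := hG' hg
    exact ((hFd d hg).symm.trans (hv d hg)).symm

theorem exists_dp2_D7 :
    ∃ G : Subgroup LatAut, G ≤ W ∧
      Nonempty (G ≃* DihedralGroup 7) ∧
      (orbs G).ncard = 4 ∧
      (∀ E ∈ Exc, (orb G E).ncard = 14 ∧ stab G E = ⊥) ∧
      MinimalAction G ∧
      (¬ ∃ C, IsConic C ∧ ∀ g ∈ G, g C = C) ∧
      CondH1 G := by
  refine ⟨dihedralHom.range, ?_, ⟨(MonoidHom.ofInjective dihedralHom_injective).symm⟩, ncard_orbs,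
    fun E hE => ⟨ncard_orb hE, stab_eq_bot hE⟩, minimalAction_range, not_exists_fixed_conic,
    condH1_range⟩
  rintro _ ⟨d, rfl⟩
  exact ⟨bil_dihedralAct d, dihedralAct_Kvec d⟩

end
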